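/- Assume F(∞) := lim_{r→∞} F(r) < ∞, P₁(∞) + P₂(∞) < ∞, and P₁(∞) + P₂(∞) < F(∞), where P_i(∞) = lim_{r→∞} P_i(r). Then there exists a bounded radial solution (u₁,u₂) with central value (a₁,a₂) such that for all r ≥ 0: a₁ + f₁(a₁,a₂)^{1/k₁}·P₁(r) ≤ u₁(r) ≤ F⁻¹(P₁(r) + P₂(r)) and a₂ + f₂(a₁,a₂)^{1/k₂}·P₂(r) ≤ u₂(r) ≤ F⁻¹(P₁(r) + P₂(r)). -/

import Mathlib

open Real Filter MeasureTheory Set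

noncomputable section

/-- A pair `(u₁, u₂)` of continuous functions on `[0, ∞)` is a radial solution of the
`(k₁,k₂)`-Hessian system with convection term, with central value `(a₁, a₂)`, in the
radial integral formulation. -/
def IsRadialSolution (k₁ k₂ : ℕ) (a₁ a₂ : ℝ)
    (B₁m B₁p B₂m B₂p : ℝ → ℝ) (f₁ f₂ : ℝ → ℝ → ℝ) (u₁ u₂ : ℝ → ℝ) : Prop :=
  ContinuousOn u₁ (Set.Ici 0) ∧ ContinuousOn u₂ (Set.Ici 0) ∧
  (∀ r ∈ Set.Ici (0:ℝ),
    u₁ r = a₁ + ∫ y in (0:ℝ)..r,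
      (B₁m y * ∫ t in (0:ℝ)..y, B₁p t * f₁ (u₁ t) (u₂ t)) ^ (1/(k₁:ℝ))) ∧
  (∀ r ∈ Set.Ici (0:ℝ),
    u₂ r = a₂ + ∫ y in (0:ℝ)..r,
      (B₂m y * ∫ t in (0:ℝ)..y, B₂p t * f₂ (u₁ t) (u₂ t)) ^ (1/(k₂:ℝ)))

/-- Knaster–Tarski on a set that contains infima of its nonempty subsets. -/
theorem exists_fixedPoint_of_monotoneOn {α : Type*} [PartialOrder α]
    {S : Set α} {T : α → α} {w : α} (hinf : ∀ A ⊆ S, A.Nonempty → ∃ u ∈ S, IsGLB A u)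
    (hT : MonotoneOn T S) (hw : w ∈ S) (hTw : T w ≤ w) (hmaps : MapsTo T S S) :
    ∃ u ∈ S, u ≤ w ∧ T u = u := by
  set A : Set α := {v | v ∈ S ∧ T v ≤ v}
  obtain ⟨u, hu, hglb⟩ := hinf A (fun v hv => hv.1) ⟨w, hw, hTw⟩
  have hTu : T u ≤ u := hglb.2 fun v hv => (hT hu hv.1 (hglb.1 hv)).trans hv.2
  have hTS := hmaps hu
  exact ⟨u, hu, hglb.1 ⟨hw, hTw⟩, hTu.antisymm (hglb.1 ⟨hTS, hT hTS hu hTu⟩)⟩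

/-- The separable equation `Φ' = g(Φ) Q`, `Φ 0 = a`, solved by inverting `∫ 1/g`. -/
theorem exists_monotone_separable_solution {a M : ℝ} {g Q : ℝ → ℝ}
    (hg : ContinuousOn g (Ici a)) (hgpos : ∀ t, a ≤ t → 0 < g t)
    (hQ : ContinuousOn Q (Ici 0)) (hQ0 : ∀ t ∈ Ici (0:ℝ), 0 ≤ Q t) (haM : a ≤ M)
    (hM : ∀ r, 0 ≤ r → ∫ t in (0:ℝ)..r, Q t ≤ ∫ t in a..M, 1 / g t) :
    ∃ Φ : ℝ → ℝ, Monotone Φ ∧ (∀ r, a ≤ Φ r ∧ Φ r ≤ M) ∧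
      ∀ r, 0 ≤ r → (∫ t in a..(Φ r), 1 / g t) = ∫ t in (0:ℝ)..r, Q t ∧
        Φ r = a + ∫ y in (0:ℝ)..r, g (Φ y) * Q y := by
  set γ : ℝ → ℝ := fun t => g (max a (min M t)) with hγ
  have hγc : Continuous γ := hg.comp_continuous (by fun_prop) fun t => mem_Ici.2 (le_max_left _ _)
  have hγpos : ∀ t, 0 < γ t := fun t => hgpos _ (le_max_left _ _)
  have hγeq : ∀ t, a ≤ t → t ≤ M → γ t = g t := fun t h1 h2 => by
    simp only [hγ, min_eq_right h2, max_eq_right h1]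
  obtain ⟨C, hC⟩ := isCompact_Icc.exists_bound_of_continuousOn
    (hg.mono (Icc_subset_Ici_self : Icc a M ⊆ Ici a))
  have hγC : ∀ t, γ t ≤ C := fun t => (le_abs_self _).trans
    (hC _ ⟨le_max_left _ _, max_le haM (min_le_left _ _)⟩)
  have hCpos : 0 < C := (hγpos 0).trans_le (hγC 0)
  have hinvc : Continuous fun t => 1 / γ t := continuous_const.div hγc fun t => (hγpos t).ne'
  set G : ℝ → ℝ := fun s => ∫ t in a..s, 1 / γ t with hG
  have hGd : ∀ s, HasDerivAt G (1 / γ s) s := fun s =>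
    intervalIntegral.integral_hasDerivAt_right (hinvc.intervalIntegrable _ _)
      (hinvc.stronglyMeasurableAtFilter _ _) hinvc.continuousAt
  have hGc : Continuous G := continuous_iff_continuousAt.2 fun s => (hGd s).continuousAt
  have hGmono : StrictMono G := strictMono_of_hasDerivAt_pos hGd fun s => by
    have := hγpos s
    positivity
  have hlow : Monotone fun s => G s - s / C := by
    refine monotone_of_hasDerivAt_nonneg
      (fun s => (hGd s).sub ((hasDerivAt_id s).div_const C)) fun s => ?_
    exact sub_nonneg.2 (one_div_le_one_div_of_le (hγpos s) (hγC s))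
  have hGa : G a = 0 := intervalIntegral.integral_same
  have hsurj : Function.Surjective G := by
    refine hGc.surjective ?_ ?_
    · refine tendsto_atTop_mono' _ (f₁ := fun s => (s - a) / C) ?_ ?_
      · filter_upwards [eventually_ge_atTop a] with s hs
        have := hlow hs
        simp only [hGa] at this
        rw [sub_div]
        linarith
      · exact (tendsto_atTop_add_const_right _ (-a) tendsto_id).atTop_div_const hCpos
    · refine tendsto_atBot_mono' _ (f₁ := fun s => (s - a) / C) ?_ ?_
      · filter_upwards [eventually_le_atBot a] with s hs
        have := hlow hs
        simp only [hGa] at this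
        rw [sub_div]
        linarith
      · exact (tendsto_atBot_add_const_right _ (-a) tendsto_id).atBot_div_const hCpos
  set e := hGmono.orderIsoOfSurjective G hsurj
  have heG : ∀ x, G (e.symm x) = x := fun x => e.apply_symm_apply x
  have hGe : ∀ x, e.symm (G x) = x := fun x => e.symm_apply_apply x
  set q : ℝ → ℝ := fun t => Q (max t 0)
  have hqc : Continuous q := hQ.comp_continuous (by fun_prop) fun t => mem_Ici.2 (le_max_right _ _)
  have hq0 : ∀ t, 0 ≤ q t := fun t => hQ0 _ (mem_Ici.2 (le_max_right _ _))
  have hqQ : ∀ r, 0 ≤ r → ∫ t in (0:ℝ)..r, q t = ∫ t in (0:ℝ)..r, Q t := fun r hr =>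
    intervalIntegral.integral_congr fun t ht => by
      rw [uIcc_of_le hr] at ht
      simp only [q, max_eq_left ht.1]
  set R : ℝ → ℝ := fun r => ∫ t in (0:ℝ)..r, q t with hR
  have hRd : ∀ s, HasDerivAt R (q s) s := fun s =>
    intervalIntegral.integral_hasDerivAt_right (hqc.intervalIntegrable _ _)
      (hqc.stronglyMeasurableAtFilter _ _) hqc.continuousAt
  have hRmono : Monotone R := monotone_of_hasDerivAt_nonneg hRd hq0
  have hR0 : R 0 = 0 := intervalIntegral.integral_same
  have hGM : G M = ∫ t in a..M, 1 / g t :=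
    intervalIntegral.integral_congr fun t ht => by
      rw [uIcc_of_le haM] at ht
      simp only [hγeq t ht.1 ht.2]
  have hbound : ∀ r, 0 ≤ r → a ≤ e.symm (R r) ∧ e.symm (R r) ≤ M := fun r hr => by
    constructor
    · rw [← hGe a]
      refine e.symm.monotone ?_
      rw [hGa, ← hR0]
      exact hRmono hr
    · rw [← hGe M]
      refine e.symm.monotone ?_
      rw [hGM, hR]
      exact (hqQ r hr).trans_le (hM r hr)
  have hd : ∀ r, 0 ≤ r → HasDerivAt (fun r => e.symm (R r)) (g (e.symm (R r)) * q r) r := by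
    intro r hr
    have h1 := (hGd (e.symm (R r))).of_local_left_inverse e.symm.continuous.continuousAt
      (by have := hγpos (e.symm (R r)); positivity) (Eventually.of_forall heG)
    have h2 := h1.comp r (hRd r)
    rw [one_div, inv_inv, hγeq _ (hbound r hr).1 (hbound r hr).2] at h2
    exact h2
  refine ⟨fun r => e.symm (R (max r 0)), ?_, fun r => hbound _ (le_max_right _ _), ?_⟩
  · exact fun r s h => e.symm.monotone (hRmono (max_le_max_right 0 h))
  · intro r hr
    have hbr := hbound r hr
    simp only [max_eq_left hr]
    constructor
    · rw [← hqQ r hr]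
      refine Eq.trans ?_ (heG (R r))
      refine intervalIntegral.integral_congr fun t ht => ?_
      rw [uIcc_of_le hbr.1] at ht
      simp only [hγeq t ht.1 (ht.2.trans hbr.2)]
    · have hΦc : Continuous fun r => e.symm (R r) :=
        e.symm.continuous.comp (continuous_iff_continuousAt.2 fun s => (hRd s).continuousAt)
      have hftc := intervalIntegral.integral_eq_sub_of_hasDerivAt (a := 0) (b := r)
        (f := fun r => e.symm (R r)) (f' := fun r => g (e.symm (R r)) * q r)
        (fun t ht => hd t (by rw [uIcc_of_le hr] at ht; exact ht.1))
        (ContinuousOn.intervalIntegrable (by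
          rw [uIcc_of_le hr]
          exact (hg.comp hΦc.continuousOn fun t ht => (hbound t ht.1).1).mul hqc.continuousOn))
      have h0 : e.symm (R 0) = a := by rw [hR0, ← hGa, hGe]
      rw [h0] at hftc
      have hcongr : ∫ y in (0:ℝ)..r, g (e.symm (R (max y 0))) * Q y
          = ∫ y in (0:ℝ)..r, g (e.symm (R y)) * q y :=
        intervalIntegral.integral_congr fun t ht => by
          rw [uIcc_of_le hr] at ht
          simp only [q, max_eq_left ht.1]
      rw [hcongr, hftc]
      ring

/-- The integrand `(m(y) ∫₀^y p h)^κ` of the radial integral operator. -/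
def radialIntegrand (κ : ℝ) (m p h : ℝ → ℝ) (y : ℝ) : ℝ :=
  (m y * ∫ t in (0:ℝ)..y, p t * h t) ^ κ

/-- Weights for which the radial integral operator is well behaved up to the origin. -/
structure IsRadialKernel (κ : ℝ) (m p : ℝ → ℝ) : Prop where
  exponent_pos : 0 < κ
  outer_nonneg : ∀ y, 0 ≤ y → 0 ≤ m y
  outer_continuousOn : ContinuousOn m (Ioi 0)
  inner_nonneg : ∀ y, 0 ≤ y → 0 ≤ p y
  inner_continuousOn : ContinuousOn p (Ici 0)
  continuousOn : ContinuousOn (fun y => (m y * ∫ t in (0:ℝ)..y, p t) ^ κ) (Ici 0)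

namespace IsRadialKernel

variable {κ : ℝ} {m p h h' : ℝ → ℝ}

theorem intervalIntegrable_mul (hk : IsRadialKernel κ m p) (hh : Monotone h) {y : ℝ}
    (hy : 0 ≤ y) : IntervalIntegrable (fun t => p t * h t) volume 0 y := by
  refine hh.intervalIntegrable.continuousOn_mul (hk.inner_continuousOn.mono ?_)
  rw [uIcc_of_le hy]
  exact Icc_subset_Ici_self

theorem integral_mul_nonneg (hk : IsRadialKernel κ m p) (h0 : ∀ t, 0 ≤ h t) {y : ℝ}
    (hy : 0 ≤ y) : 0 ≤ ∫ t in (0:ℝ)..y, p t * h t :=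
  intervalIntegral.integral_nonneg hy fun t ht => mul_nonneg (hk.inner_nonneg t ht.1) (h0 t)

theorem nonneg (hk : IsRadialKernel κ m p) (h0 : ∀ t, 0 ≤ h t) {y : ℝ} (hy : 0 ≤ y) :
    0 ≤ radialIntegrand κ m p h y :=
  rpow_nonneg (mul_nonneg (hk.outer_nonneg y hy) (hk.integral_mul_nonneg h0 hy)) _

theorem integrand_mono (hk : IsRadialKernel κ m p) (hh : Monotone h) (hh' : Monotone h')
    (h0 : ∀ t, 0 ≤ h t) {y : ℝ} (hy : 0 ≤ y) (hle : ∀ t, t ≤ y → h t ≤ h' t) :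
    radialIntegrand κ m p h y ≤ radialIntegrand κ m p h' y := by
  refine rpow_le_rpow (mul_nonneg (hk.outer_nonneg y hy) (hk.integral_mul_nonneg h0 hy)) ?_
    hk.exponent_pos.le
  refine mul_le_mul_of_nonneg_left ?_ (hk.outer_nonneg y hy)
  exact intervalIntegral.integral_mono_on hy (hk.intervalIntegrable_mul hh hy)
    (hk.intervalIntegrable_mul hh' hy)
    fun t ht => mul_le_mul_of_nonneg_left (hle t ht.2) (hk.inner_nonneg t ht.1)

theorem integrand_const (hk : IsRadialKernel κ m p) {c : ℝ} (hc : 0 ≤ c) {y : ℝ}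
    (hy : 0 ≤ y) : radialIntegrand κ m p (fun _ => c) y
      = c ^ κ * (m y * ∫ t in (0:ℝ)..y, p t) ^ κ := by
  have hp : 0 ≤ ∫ t in (0:ℝ)..y, p t :=
    intervalIntegral.integral_nonneg hy fun t ht => hk.inner_nonneg t ht.1
  rw [← mul_rpow hc (mul_nonneg (hk.outer_nonneg y hy) hp), radialIntegrand,
    intervalIntegral.integral_mul_const]
  ring_nf

theorem integrand_le (hk : IsRadialKernel κ m p) (hh : Monotone h) (h0 : ∀ t, 0 ≤ h t)
    {y : ℝ} (hy : 0 ≤ y) {c : ℝ} (hc : h y ≤ c) : radialIntegrand κ m p h y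
      ≤ c ^ κ * (m y * ∫ t in (0:ℝ)..y, p t) ^ κ := by
  rw [← hk.integrand_const ((h0 y).trans hc) hy]
  exact hk.integrand_mono hh monotone_const h0 hy fun t ht => (hh ht).trans hc

theorem le_integrand (hk : IsRadialKernel κ m p) (hh : Monotone h)
    {y : ℝ} (hy : 0 ≤ y) {c : ℝ} (hc0 : 0 ≤ c) (hc : ∀ t, c ≤ h t) :
    c ^ κ * (m y * ∫ t in (0:ℝ)..y, p t) ^ κ ≤ radialIntegrand κ m p h y := by
  rw [← hk.integrand_const hc0 hy]
  exact hk.integrand_mono monotone_const hh (fun _ => hc0) hy fun t _ => hc t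

theorem intervalIntegrable_weight (hk : IsRadialKernel κ m p) {r : ℝ} (hr : 0 ≤ r) :
    IntervalIntegrable (fun y => (m y * ∫ t in (0:ℝ)..y, p t) ^ κ) volume 0 r := by
  refine (hk.continuousOn.mono ?_).intervalIntegrable
  rw [uIcc_of_le hr]
  exact Icc_subset_Ici_self

theorem intervalIntegrable (hk : IsRadialKernel κ m p) (hh : Monotone h) (h0 : ∀ t, 0 ≤ h t)
    {r : ℝ} (hr : 0 ≤ r) : IntervalIntegrable (radialIntegrand κ m p h) volume 0 r := by
  refine ((hk.intervalIntegrable_weight hr).const_mul (h r ^ κ)).mono_fun' ?_ ?_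
  · rw [uIoc_of_le hr]
    refine ContinuousOn.aestronglyMeasurable ?_ measurableSet_Ioc
    refine ContinuousOn.rpow_const ?_ fun _ _ => Or.inr hk.exponent_pos.le
    refine (hk.outer_continuousOn.mono fun y hy => hy.1).mul ?_
    have := intervalIntegral.continuousOn_primitive_interval'
      (hk.intervalIntegrable_mul hh hr) left_mem_uIcc
    rw [uIcc_of_le hr] at this
    exact this.mono Ioc_subset_Icc_self
  · rw [uIoc_of_le hr]
    refine (ae_restrict_iff' measurableSet_Ioc).2 (Eventually.of_forall fun y hy => ?_)
    refine (Real.norm_of_nonneg (hk.nonneg h0 hy.1.le)).trans_le ?_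
    exact hk.integrand_le hh h0 hy.1.le (hh hy.2)

theorem integral_integrand_mono (hk : IsRadialKernel κ m p) (hh : Monotone h)
    (hh' : Monotone h') (h0 : ∀ t, 0 ≤ h t) (hle : ∀ t, h t ≤ h' t) {r : ℝ} (hr : 0 ≤ r) :
    ∫ y in (0:ℝ)..r, radialIntegrand κ m p h y ≤ ∫ y in (0:ℝ)..r, radialIntegrand κ m p h' y :=
  intervalIntegral.integral_mono_on hr (hk.intervalIntegrable hh h0 hr)
    (hk.intervalIntegrable hh' (fun t => (h0 t).trans (hle t)) hr)
    fun _ hy => hk.integrand_mono hh hh' h0 hy.1 fun t _ => hle t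

theorem integral_nonneg (hk : IsRadialKernel κ m p) (h0 : ∀ t, 0 ≤ h t) {r : ℝ} (hr : 0 ≤ r) :
    0 ≤ ∫ y in (0:ℝ)..r, radialIntegrand κ m p h y :=
  intervalIntegral.integral_nonneg hr fun _ hy => hk.nonneg h0 hy.1

theorem monotone_integral (hk : IsRadialKernel κ m p) (hh : Monotone h) (h0 : ∀ t, 0 ≤ h t) :
    Monotone fun r => ∫ y in (0:ℝ)..(max r 0), radialIntegrand κ m p h y := by
  intro r s hrs
  have hr : (0:ℝ) ≤ max r 0 := le_max_right _ _
  have hs : max r 0 ≤ max s 0 := max_le_max_right 0 hrs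
  refine intervalIntegral.integral_mono_interval le_rfl hr hs ?_
    (hk.intervalIntegrable hh h0 (hr.trans hs))
  exact (ae_restrict_iff' measurableSet_Ioc).2
    (Eventually.of_forall fun y hy => hk.nonneg h0 hy.1.le)

theorem continuousOn_integral (hk : IsRadialKernel κ m p) (hh : Monotone h)
    (h0 : ∀ t, 0 ≤ h t) :
    ContinuousOn (fun r => ∫ y in (0:ℝ)..r, radialIntegrand κ m p h y) (Ici 0) := by
  intro r hr
  have hr' : r ∈ Icc 0 (r + 1) := ⟨hr, by linarith⟩
  have := intervalIntegral.continuousOn_primitive_interval'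
    (hk.intervalIntegrable hh h0 (hr'.1.trans hr'.2)) left_mem_uIcc
  rw [uIcc_of_le (hr'.1.trans hr'.2)] at this
  refine (this r hr').mono_of_mem_nhdsWithin ?_
  rw [← Ici_inter_Iic]
  exact inter_mem_nhdsWithin _ (Iic_mem_nhds (by linarith))

theorem le_integral (hk : IsRadialKernel κ m p) (hh : Monotone h) {c : ℝ} (hc0 : 0 ≤ c)
    (hc : ∀ t, c ≤ h t) {r : ℝ} (hr : 0 ≤ r) :
    c ^ κ * (∫ y in (0:ℝ)..r, (m y * ∫ t in (0:ℝ)..y, p t) ^ κ)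
      ≤ ∫ y in (0:ℝ)..r, radialIntegrand κ m p h y := by
  rw [← intervalIntegral.integral_const_mul]
  exact intervalIntegral.integral_mono_on hr ((hk.intervalIntegrable_weight hr).const_mul _)
    (hk.intervalIntegrable hh (fun t => hc0.trans (hc t)) hr)
    fun _ hy => hk.le_integrand hh hy.1 hc0 hc

end IsRadialKernel

/-- The weights coming from a `k`-Hessian operator with convection term form a radial kernel. -/
theorem isRadialKernel_hessian {N k : ℕ} (hk : 1 ≤ k) (hkN : k ≤ N) {C : ℝ} (hC : 0 < C)
    {b p : ℝ → ℝ} (hb : ContinuousOn b (Ici 0)) (hp : ContinuousOn p (Ici 0))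
    (hp0 : ∀ t ∈ Ici (0:ℝ), 0 ≤ p t) {Bm Bp : ℝ → ℝ}
    (hBm : ∀ ξ : ℝ, Bm ξ = ξ ^ ((k : ℤ) - (N : ℤ)) / C *
      Real.exp (-(∫ t in (0:ℝ)..ξ, (1 / C) * t ^ (k - 1) * b t)))
    (hBp : ∀ ξ : ℝ, Bp ξ = ξ ^ (N - 1) *
      Real.exp (∫ t in (0:ℝ)..ξ, (1 / C) * t ^ (k - 1) * b t) * p ξ) :
    IsRadialKernel (1 / (k : ℝ)) Bm Bp := by
  have primitive_cont : ∀ φ : ℝ → ℝ, ContinuousOn φ (Ici 0) →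
      ContinuousOn (fun ξ => ∫ t in (0:ℝ)..ξ, φ t) (Ici 0) := by
    intro φ hφ
    have hc : Continuous fun t => φ (max t 0) :=
      hφ.comp_continuous (by fun_prop) fun t => mem_Ici.2 (le_max_right _ _)
    refine (intervalIntegral.continuous_primitive (μ := volume)
      (fun a b => hc.intervalIntegrable a b) 0).continuousOn.congr fun r hr => ?_
    refine intervalIntegral.integral_congr fun t ht => ?_
    rw [uIcc_of_le hr] at ht
    simp only [max_eq_left ht.1]
  have hE : ContinuousOn (fun ξ => ∫ t in (0:ℝ)..ξ, (1 / C) * t ^ (k - 1) * b t) (Ici 0) :=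
    primitive_cont _ (by fun_prop)
  set E : ℝ → ℝ := fun ξ => ∫ t in (0:ℝ)..ξ, (1 / C) * t ^ (k - 1) * b t
  have hBm0 : ∀ y, 0 ≤ y → 0 ≤ Bm y := fun y hy => by rw [hBm]; positivity
  have hBp0 : ∀ y, 0 ≤ y → 0 ≤ Bp y := fun y hy => by
    have := hp0 y hy
    rw [hBp]
    positivity
  have hBmc : ContinuousOn Bm (Ioi 0) := by
    have hEc : ContinuousOn (fun ξ => Real.exp (-E ξ)) (Ioi 0) :=
      (hE.mono Ioi_subset_Ici_self).neg.rexp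
    refine ContinuousOn.congr (ContinuousOn.mul (ContinuousOn.div_const ?_ C) hEc)
      fun ξ _ => hBm ξ
    exact fun ξ hξ => (continuousAt_zpow₀ ξ _ (Or.inl (ne_of_gt hξ))).continuousWithinAt
  set q : ℝ → ℝ := fun ξ => Real.exp (E ξ) * p ξ
  have hqc : ContinuousOn q (Ici 0) := hE.rexp.mul hp
  have hBpq : ∀ ξ, Bp ξ = ξ ^ (N - 1) * q ξ := fun ξ => by rw [hBp, mul_assoc]
  have hBpc : ContinuousOn Bp (Ici 0) :=
    ContinuousOn.congr (ContinuousOn.mul (by fun_prop) hqc) fun ξ _ => hBpq ξ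
  have hkpos : 0 < 1 / (k : ℝ) := by positivity
  refine ⟨hkpos, hBm0, hBmc, hBp0, hBpc, ?_⟩
  refine ContinuousOn.rpow_const ?_ fun _ _ => Or.inr hkpos.le
  have hI := primitive_cont _ hBpc
  intro y hy
  rcases eq_or_lt_of_le (mem_Ici.1 hy) with rfl | hy
  · have hU : ContinuousOn (fun y => y ^ (k - 1) / C * Real.exp (-E y) *
        ∫ t in (0:ℝ)..y, q t) (Ici 0) :=
      (ContinuousOn.mul (by fun_prop) hE.neg.rexp).mul (primitive_cont _ hqc)
    have hU0 := (hU 0 self_mem_Ici).tendsto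
    simp only [ContinuousWithinAt, intervalIntegral.integral_same, mul_zero] at hU0 ⊢
    refine tendsto_of_tendsto_of_tendsto_of_le_of_le' tendsto_const_nhds hU0 ?_ ?_
    · filter_upwards [self_mem_nhdsWithin] with y hy
      exact mul_nonneg (hBm0 y hy) (intervalIntegral.integral_nonneg hy fun t ht => hBp0 t ht.1)
    · filter_upwards [self_mem_nhdsWithin] with y hy
      rcases eq_or_lt_of_le (mem_Ici.1 hy) with rfl | hy
      · simp
      have hint : ∀ φ : ℝ → ℝ, ContinuousOn φ (Ici 0) → IntervalIntegrable φ volume 0 y :=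
        fun φ hφ => (hφ.mono (by rw [uIcc_of_le hy.le]; exact Icc_subset_Ici_self)).intervalIntegrable
      have h1 : ∫ t in (0:ℝ)..y, Bp t ≤ y ^ (N - 1) * ∫ t in (0:ℝ)..y, q t := by
        rw [← intervalIntegral.integral_const_mul]
        refine intervalIntegral.integral_mono_on hy.le (hint _ hBpc)
          ((hint _ hqc).const_mul _) fun t ht => ?_
        rw [hBpq]
        exact mul_le_mul_of_nonneg_right (pow_le_pow_left₀ ht.1 ht.2 _)
          (mul_nonneg (Real.exp_pos _).le (hp0 t ht.1))
      have h2 : y ^ ((k : ℤ) - (N : ℤ)) * y ^ (N - 1) = y ^ (k - 1) := by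
        rw [← zpow_natCast, ← zpow_natCast, ← zpow_add₀ hy.ne']
        congr 1
        omega
      calc Bm y * ∫ t in (0:ℝ)..y, Bp t
          ≤ Bm y * (y ^ (N - 1) * ∫ t in (0:ℝ)..y, q t) :=
            mul_le_mul_of_nonneg_left h1 (hBm0 y hy.le)
        _ = y ^ (k - 1) / C * Real.exp (-E y) * ∫ t in (0:ℝ)..y, q t := by
            rw [hBm, ← h2]
            ring
  · exact ((hBmc.continuousAt (Ioi_mem_nhds hy)).mul
      (hI.continuousAt (Ici_mem_nhds hy))).continuousWithinAt

/-- A nondecreasing radial system with a common supersolution `Φ` has a solution below `Φ`. -/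
theorem exists_radial_solution_of_supersolution {κ₁ κ₂ a₁ a₂ : ℝ} {m₁ p₁ m₂ p₂ Φ : ℝ → ℝ}
    {f₁ f₂ : ℝ → ℝ → ℝ} (hk₁ : IsRadialKernel κ₁ m₁ p₁) (hk₂ : IsRadialKernel κ₂ m₂ p₂)
    (ha₁ : 0 ≤ a₁) (ha₂ : 0 ≤ a₂)
    (hf₁0 : ∀ x ∈ Ici (0:ℝ), ∀ y ∈ Ici (0:ℝ), 0 ≤ f₁ x y)
    (hf₂0 : ∀ x ∈ Ici (0:ℝ), ∀ y ∈ Ici (0:ℝ), 0 ≤ f₂ x y)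
    (hf₁ : ∀ x x' y y' : ℝ, 0 ≤ x → x ≤ x' → 0 ≤ y → y ≤ y' → f₁ x y ≤ f₁ x' y')
    (hf₂ : ∀ x x' y y' : ℝ, 0 ≤ x → x ≤ x' → 0 ≤ y → y ≤ y' → f₂ x y ≤ f₂ x' y')
    (hΦ : Monotone Φ) (hΦ₁ : ∀ r, a₁ ≤ Φ r) (hΦ₂ : ∀ r, a₂ ≤ Φ r)
    (hsup₁ : ∀ r, 0 ≤ r →
      a₁ + ∫ y in (0:ℝ)..r, radialIntegrand κ₁ m₁ p₁ (fun t => f₁ (Φ t) (Φ t)) y ≤ Φ r)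
    (hsup₂ : ∀ r, 0 ≤ r →
      a₂ + ∫ y in (0:ℝ)..r, radialIntegrand κ₂ m₂ p₂ (fun t => f₂ (Φ t) (Φ t)) y ≤ Φ r) :
    ∃ u₁ u₂ : ℝ → ℝ, Monotone u₁ ∧ Monotone u₂ ∧ (∀ r, a₁ ≤ u₁ r) ∧ (∀ r, a₂ ≤ u₂ r) ∧
      (∀ r, u₁ r ≤ Φ r) ∧ (∀ r, u₂ r ≤ Φ r) ∧
      (∀ r, 0 ≤ r → u₁ r =
        a₁ + ∫ y in (0:ℝ)..r, radialIntegrand κ₁ m₁ p₁ (fun t => f₁ (u₁ t) (u₂ t)) y) ∧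
      (∀ r, 0 ≤ r → u₂ r =
        a₂ + ∫ y in (0:ℝ)..r, radialIntegrand κ₂ m₂ p₂ (fun t => f₂ (u₁ t) (u₂ t)) y) := by
  set S : Set ((ℝ → ℝ) × (ℝ → ℝ)) :=
    {v | Monotone v.1 ∧ Monotone v.2 ∧ (∀ r, a₁ ≤ v.1 r) ∧ ∀ r, a₂ ≤ v.2 r}
  set T : (ℝ → ℝ) × (ℝ → ℝ) → (ℝ → ℝ) × (ℝ → ℝ) := fun v =>
    (fun r => a₁ + ∫ y in (0:ℝ)..(max r 0),
        radialIntegrand κ₁ m₁ p₁ (fun t => f₁ (v.1 t) (v.2 t)) y,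
      fun r => a₂ + ∫ y in (0:ℝ)..(max r 0),
        radialIntegrand κ₂ m₂ p₂ (fun t => f₂ (v.1 t) (v.2 t)) y)
  have comp_mono : ∀ f : ℝ → ℝ → ℝ,
      (∀ x x' y y' : ℝ, 0 ≤ x → x ≤ x' → 0 ≤ y → y ≤ y' → f x y ≤ f x' y') →
      ∀ v ∈ S, Monotone fun t => f (v.1 t) (v.2 t) := fun f hf v hv s t hst =>
    hf _ _ _ _ (ha₁.trans (hv.2.2.1 s)) (hv.1 hst) (ha₂.trans (hv.2.2.2 s)) (hv.2.1 hst)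
  have comp_nonneg : ∀ f : ℝ → ℝ → ℝ, (∀ x ∈ Ici (0:ℝ), ∀ y ∈ Ici (0:ℝ), 0 ≤ f x y) →
      ∀ v ∈ S, ∀ t, 0 ≤ f (v.1 t) (v.2 t) := fun f hf v hv t =>
    hf _ (ha₁.trans (hv.2.2.1 t)) _ (ha₂.trans (hv.2.2.2 t))
  have hinf : ∀ A ⊆ S, A.Nonempty → ∃ u ∈ S, IsGLB A u := by
    intro A hA hne
    have exists_glb : ∀ (B : Set (ℝ → ℝ)) (a : ℝ), B.Nonempty →
        (∀ v ∈ B, Monotone v ∧ ∀ r, a ≤ v r) →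
        ∃ w, IsGLB B w ∧ Monotone w ∧ ∀ r, a ≤ w r := by
      intro B a hBne hB
      have hlow : (fun _ => a) ∈ lowerBounds B := fun v hv => (hB v hv).2
      have hw := isGLB_csInf hBne ⟨_, hlow⟩
      refine ⟨sInf B, hw, fun s t hst => ?_, hw.2 hlow⟩
      have hw' := isGLB_pi.1 hw
      refine (hw' t).2 ?_
      rintro _ ⟨v, hv, rfl⟩
      exact ((hw' s).1 ⟨v, hv, rfl⟩).trans ((hB v hv).1 hst)
    obtain ⟨w₁, hw₁, hm₁, hl₁⟩ := exists_glb (Prod.fst '' A) a₁ (hne.image _) (by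
      rintro _ ⟨v, hv, rfl⟩
      exact ⟨(hA hv).1, (hA hv).2.2.1⟩)
    obtain ⟨w₂, hw₂, hm₂, hl₂⟩ := exists_glb (Prod.snd '' A) a₂ (hne.image _) (by
      rintro _ ⟨v, hv, rfl⟩
      exact ⟨(hA hv).2.1, (hA hv).2.2.2⟩)
    exact ⟨(w₁, w₂), ⟨hm₁, hm₂, hl₁, hl₂⟩, isGLB_prod.2 ⟨hw₁, hw₂⟩⟩
  have hmaps : MapsTo T S S := by
    intro v hv
    refine ⟨?_, ?_, fun r => ?_, fun r => ?_⟩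
    · exact (hk₁.monotone_integral (comp_mono f₁ hf₁ v hv) (comp_nonneg f₁ hf₁0 v hv)).const_add a₁
    · exact (hk₂.monotone_integral (comp_mono f₂ hf₂ v hv) (comp_nonneg f₂ hf₂0 v hv)).const_add a₂
    · exact le_add_of_nonneg_right
        (hk₁.integral_nonneg (comp_nonneg f₁ hf₁0 v hv) (le_max_right _ _))
    · exact le_add_of_nonneg_right
        (hk₂.integral_nonneg (comp_nonneg f₂ hf₂0 v hv) (le_max_right _ _))
  have hT : MonotoneOn T S := by
    intro v hv w hw hvw
    refine ⟨fun r => add_le_add_right ?_ a₁, fun r => add_le_add_right ?_ a₂⟩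
    · exact hk₁.integral_integrand_mono (comp_mono f₁ hf₁ v hv) (comp_mono f₁ hf₁ w hw)
        (comp_nonneg f₁ hf₁0 v hv) (fun t => hf₁ _ _ _ _ (ha₁.trans (hv.2.2.1 t)) (hvw.1 t)
          (ha₂.trans (hv.2.2.2 t)) (hvw.2 t)) (le_max_right _ _)
    · exact hk₂.integral_integrand_mono (comp_mono f₂ hf₂ v hv) (comp_mono f₂ hf₂ w hw)
        (comp_nonneg f₂ hf₂0 v hv) (fun t => hf₂ _ _ _ _ (ha₁.trans (hv.2.2.1 t)) (hvw.1 t)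
          (ha₂.trans (hv.2.2.2 t)) (hvw.2 t)) (le_max_right _ _)
  have hTw : T (Φ, Φ) ≤ (Φ, Φ) := by
    refine ⟨fun r => ?_, fun r => ?_⟩ <;> rcases le_total 0 r with hr | hr
    · simpa only [T, max_eq_left hr] using hsup₁ r hr
    · simpa only [T, max_eq_right hr, intervalIntegral.integral_same, add_zero] using hΦ₁ r
    · simpa only [T, max_eq_left hr] using hsup₂ r hr
    · simpa only [T, max_eq_right hr, intervalIntegral.integral_same, add_zero] using hΦ₂ r
  obtain ⟨u, hu, hle, hfix⟩ := exists_fixedPoint_of_monotoneOn hinf hT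
    (⟨hΦ, hΦ, hΦ₁, hΦ₂⟩ : (Φ, Φ) ∈ S) hTw hmaps
  refine ⟨u.1, u.2, hu.1, hu.2.1, hu.2.2.1, hu.2.2.2, hle.1, hle.2, fun r hr => ?_,
    fun r hr => ?_⟩
  · have := congrFun (congrArg Prod.fst hfix) r
    simp only [T, max_eq_left hr] at this
    exact this.symm
  · have := congrFun (congrArg Prod.snd hfix) r
    simp only [T, max_eq_left hr] at this
    exact this.symm

/-- Theorem 2: if `F(∞) < ∞`, `P₁(∞) + P₂(∞) < ∞` and `P₁(∞) + P₂(∞) < F(∞)`, then the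
system has a bounded radial solution with central value `(a₁, a₂)` satisfying the
two-sided bounds
`aᵢ + fᵢ(a₁,a₂)^{1/kᵢ} Pᵢ(r) ≤ uᵢ(r) ≤ F⁻¹(P₁(r) + P₂(r))`. -/
theorem hessian_system_bounded_solution
    (N k₁ k₂ : ℕ) (hN : 3 ≤ N) (hk₁ : 1 ≤ k₁) (hk₁N : k₁ ≤ N) (hk₂ : 1 ≤ k₂) (hk₂N : k₂ ≤ N)
    (b₁ b₂ p₁ p₂ : ℝ → ℝ)
    (hb₁c : ContinuousOn b₁ (Set.Ici 0)) (hb₂c : ContinuousOn b₂ (Set.Ici 0))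
    (hp₁c : ContinuousOn p₁ (Set.Ici 0)) (hp₂c : ContinuousOn p₂ (Set.Ici 0))
    (hb₁0 : ∀ t ∈ Set.Ici (0:ℝ), 0 ≤ b₁ t) (hb₂0 : ∀ t ∈ Set.Ici (0:ℝ), 0 ≤ b₂ t)
    (hp₁0 : ∀ t ∈ Set.Ici (0:ℝ), 0 ≤ p₁ t) (hp₂0 : ∀ t ∈ Set.Ici (0:ℝ), 0 ≤ p₂ t)
    (C₀ C₀₀ : ℝ)
    (hC₀ : C₀ = (Nat.factorial (N-1) : ℝ) / ((Nat.factorial k₁ : ℝ) * (Nat.factorial (N - k₁) : ℝ)))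
    (hC₀₀ : C₀₀ = (Nat.factorial (N-1) : ℝ) / ((Nat.factorial k₂ : ℝ) * (Nat.factorial (N - k₂) : ℝ)))
    (B₁m B₁p B₂m B₂p : ℝ → ℝ)
    (hB₁m : ∀ ξ : ℝ, B₁m ξ = ξ ^ ((k₁ : ℤ) - (N : ℤ)) / C₀ *
      Real.exp (-(∫ t in (0:ℝ)..ξ, (1 / C₀) * t ^ (k₁ - 1) * b₁ t)))
    (hB₁p : ∀ ξ : ℝ, B₁p ξ = ξ ^ (N - 1) *
      Real.exp (∫ t in (0:ℝ)..ξ, (1 / C₀) * t ^ (k₁ - 1) * b₁ t) * p₁ ξ)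
    (hB₂m : ∀ ξ : ℝ, B₂m ξ = ξ ^ ((k₂ : ℤ) - (N : ℤ)) / C₀₀ *
      Real.exp (-(∫ t in (0:ℝ)..ξ, (1 / C₀₀) * t ^ (k₂ - 1) * b₂ t)))
    (hB₂p : ∀ ξ : ℝ, B₂p ξ = ξ ^ (N - 1) *
      Real.exp (∫ t in (0:ℝ)..ξ, (1 / C₀₀) * t ^ (k₂ - 1) * b₂ t) * p₂ ξ)
    (a₁ a₂ : ℝ) (ha₁ : 0 ≤ a₁) (ha₂ : 0 ≤ a₂) (ha : 0 < a₁ + a₂)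
    (f₁ f₂ : ℝ → ℝ → ℝ)
    (hf₁c : ContinuousOn (fun q : ℝ × ℝ => f₁ q.1 q.2) (Set.Ici 0 ×ˢ Set.Ici 0))
    (hf₂c : ContinuousOn (fun q : ℝ × ℝ => f₂ q.1 q.2) (Set.Ici 0 ×ˢ Set.Ici 0))
    (hf₁0 : ∀ x ∈ Set.Ici (0:ℝ), ∀ y ∈ Set.Ici (0:ℝ), 0 ≤ f₁ x y)
    (hf₂0 : ∀ x ∈ Set.Ici (0:ℝ), ∀ y ∈ Set.Ici (0:ℝ), 0 ≤ f₂ x y)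
    (hf₁mono : ∀ x xQ y yQ : ℝ, 0 ≤ x → x ≤ xQ → 0 ≤ y → y ≤ yQ → f₁ x y ≤ f₁ xQ yQ)
    (hf₂mono : ∀ x xQ y yQ : ℝ, 0 ≤ x → x ≤ xQ → 0 ≤ y → y ≤ yQ → f₂ x y ≤ f₂ xQ yQ)
    (P₁ P₂ : ℝ → ℝ)
    (hP₁ : ∀ r : ℝ, P₁ r = ∫ t in (0:ℝ)..r, (B₁m t * ∫ s in (0:ℝ)..t, B₁p s) ^ (1/(k₁:ℝ)))
    (hP₂ : ∀ r : ℝ, P₂ r = ∫ t in (0:ℝ)..r, (B₂m t * ∫ s in (0:ℝ)..t, B₂p s) ^ (1/(k₂:ℝ)))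
    (F : ℝ → ℝ)
    (hF : ∀ r : ℝ, F r = ∫ t in (a₁+a₂)..r, 1 / (f₁ t t ^ (1/(k₁:ℝ)) + f₂ t t ^ (1/(k₂:ℝ))))
    (hfpos : ∀ t : ℝ, a₁ + a₂ ≤ t → 0 < f₁ t t ^ (1/(k₁:ℝ)) + f₂ t t ^ (1/(k₂:ℝ)))
    (Flim : ℝ) (hFlim : Tendsto F atTop (nhds Flim))
    (P₁lim P₂lim : ℝ)
    (hP₁lim : Tendsto P₁ atTop (nhds P₁lim)) (hP₂lim : Tendsto P₂ atTop (nhds P₂lim))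
    (hPltF : P₁lim + P₂lim < Flim)
    (Finv : ℝ → ℝ) (hFinv : ∀ s : ℝ, a₁ + a₂ ≤ s → Finv (F s) = s) :
    ∃ u₁ u₂ : ℝ → ℝ,
      IsRadialSolution k₁ k₂ a₁ a₂ B₁m B₁p B₂m B₂p f₁ f₂ u₁ u₂ ∧
      BddAbove (u₁ '' Set.Ici 0) ∧ BddAbove (u₂ '' Set.Ici 0) ∧
      ∀ r ∈ Set.Ici (0:ℝ),
        a₁ + f₁ a₁ a₂ ^ (1/(k₁:ℝ)) * P₁ r ≤ u₁ r ∧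
        u₁ r ≤ Finv (P₁ r + P₂ r) ∧
        a₂ + f₂ a₁ a₂ ^ (1/(k₂:ℝ)) * P₂ r ≤ u₂ r ∧
        u₂ r ≤ Finv (P₁ r + P₂ r) := by
  have hC₀pos : 0 < C₀ := by rw [hC₀]; positivity
  have hC₀₀pos : 0 < C₀₀ := by rw [hC₀₀]; positivity
  have hK₁ := isRadialKernel_hessian hk₁ hk₁N hC₀pos hb₁c hp₁c hp₁0 hB₁m hB₁p
  have hK₂ := isRadialKernel_hessian hk₂ hk₂N hC₀₀pos hb₂c hp₂c hp₂0 hB₂m hB₂p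
  set κ₁ : ℝ := 1 / (k₁ : ℝ)
  set κ₂ : ℝ := 1 / (k₂ : ℝ)
  set Q₁ : ℝ → ℝ := fun t => (B₁m t * ∫ s in (0:ℝ)..t, B₁p s) ^ κ₁
  set Q₂ : ℝ → ℝ := fun t => (B₂m t * ∫ s in (0:ℝ)..t, B₂p s) ^ κ₂
  set g : ℝ → ℝ := fun t => f₁ t t ^ κ₁ + f₂ t t ^ κ₂
  have hQ₁0 : ∀ t, 0 ≤ t → 0 ≤ Q₁ t := fun t ht =>
    rpow_nonneg (mul_nonneg (hK₁.outer_nonneg t ht)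
      (intervalIntegral.integral_nonneg ht fun s hs => hK₁.inner_nonneg s hs.1)) _
  have hQ₂0 : ∀ t, 0 ≤ t → 0 ≤ Q₂ t := fun t ht =>
    rpow_nonneg (mul_nonneg (hK₂.outer_nonneg t ht)
      (intervalIntegral.integral_nonneg ht fun s hs => hK₂.inner_nonneg s hs.1)) _
  have hPadd : ∀ r, 0 ≤ r → ∫ t in (0:ℝ)..r, (Q₁ t + Q₂ t) = P₁ r + P₂ r := fun r hr => by
    rw [hP₁, hP₂]
    exact intervalIntegral.integral_add (hK₁.intervalIntegrable_weight hr)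
      (hK₂.intervalIntegrable_weight hr)
  have primitive_le_limit : ∀ (Q P : ℝ → ℝ) (L : ℝ), ContinuousOn Q (Ici 0) →
      (∀ t, 0 ≤ t → 0 ≤ Q t) → (∀ r, P r = ∫ t in (0:ℝ)..r, Q t) →
      Tendsto P atTop (nhds L) → ∀ r, 0 ≤ r → P r ≤ L := by
    intro Q P L hQ hQ0 hP hL r hr
    refine ge_of_tendsto hL ?_
    filter_upwards [eventually_ge_atTop r] with s hs
    rw [hP, hP]
    refine intervalIntegral.integral_mono_interval le_rfl hr hs ?_ ?_
    · exact (ae_restrict_iff' measurableSet_Ioc).2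
        (Eventually.of_forall fun y hy => hQ0 y hy.1.le)
    · refine (hQ.mono ?_).intervalIntegrable
      rw [uIcc_of_le (hr.trans hs)]
      exact Icc_subset_Ici_self
  obtain ⟨M, hMF, haM⟩ := ((hFlim.eventually (eventually_gt_nhds hPltF)).and
    (eventually_ge_atTop (a₁ + a₂))).exists
  have diag : ∀ t ∈ Ici (a₁ + a₂), (t, t) ∈ Ici (0:ℝ) ×ˢ Ici (0:ℝ) := fun t ht =>
    ⟨ha.le.trans ht, ha.le.trans ht⟩
  have hgc : ContinuousOn g (Ici (a₁ + a₂)) := by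
    refine ContinuousOn.add (ContinuousOn.rpow_const ?_ fun _ _ => Or.inr hK₁.exponent_pos.le)
      (ContinuousOn.rpow_const ?_ fun _ _ => Or.inr hK₂.exponent_pos.le)
    · exact hf₁c.comp (f := fun t : ℝ => (t, t)) (by fun_prop) diag
    · exact hf₂c.comp (f := fun t : ℝ => (t, t)) (by fun_prop) diag
  obtain ⟨Φ, hΦmono, hΦmem, hΦ⟩ := exists_monotone_separable_solution
    (Q := fun t => Q₁ t + Q₂ t) hgc hfpos
    (hK₁.continuousOn.add hK₂.continuousOn)
    (fun t ht => add_nonneg (hQ₁0 t ht) (hQ₂0 t ht)) haM (fun r hr => by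
      rw [← hF M]
      refine (hPadd r hr).trans_le (le_trans (add_le_add ?_ ?_) hMF.le)
      · exact primitive_le_limit Q₁ P₁ _ hK₁.continuousOn hQ₁0 hP₁ hP₁lim r hr
      · exact primitive_le_limit Q₂ P₂ _ hK₂.continuousOn hQ₂0 hP₂ hP₂lim r hr)
  have hΦ0 : ∀ r, 0 ≤ Φ r := fun r => ha.le.trans (hΦmem r).1
  have hg₁0 : ∀ t, 0 ≤ f₁ (Φ t) (Φ t) := fun t => hf₁0 _ (hΦ0 t) _ (hΦ0 t)
  have hg₂0 : ∀ t, 0 ≤ f₂ (Φ t) (Φ t) := fun t => hf₂0 _ (hΦ0 t) _ (hΦ0 t)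
  have hg₁m : Monotone fun t => f₁ (Φ t) (Φ t) := fun s t h =>
    hf₁mono _ _ _ _ (hΦ0 s) (hΦmono h) (hΦ0 s) (hΦmono h)
  have hg₂m : Monotone fun t => f₂ (Φ t) (Φ t) := fun s t h =>
    hf₂mono _ _ _ _ (hΦ0 s) (hΦmono h) (hΦ0 s) (hΦmono h)
  have hΦint : ∀ r, 0 ≤ r →
      IntervalIntegrable (fun y => g (Φ y) * (Q₁ y + Q₂ y)) volume 0 r := by
    intro r hr
    have hm : Monotone fun y => g (Φ y) := fun s t h =>
      add_le_add (rpow_le_rpow (hg₁0 s) (hg₁m h) hK₁.exponent_pos.le)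
        (rpow_le_rpow (hg₂0 s) (hg₂m h) hK₂.exponent_pos.le)
    refine hm.intervalIntegrable.mul_continuousOn
      ((hK₁.continuousOn.add hK₂.continuousOn).mono ?_)
    rw [uIcc_of_le hr]
    exact Icc_subset_Ici_self
  have hsup₁ : ∀ r, 0 ≤ r →
      a₁ + ∫ y in (0:ℝ)..r, radialIntegrand κ₁ B₁m B₁p (fun t => f₁ (Φ t) (Φ t)) y ≤ Φ r := by
    intro r hr
    rw [(hΦ r hr).2]
    refine add_le_add (by linarith) (intervalIntegral.integral_mono_on hr
      (hK₁.intervalIntegrable hg₁m hg₁0 hr) (hΦint r hr) fun y hy => ?_)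
    refine (hK₁.integrand_le hg₁m hg₁0 hy.1 le_rfl).trans ?_
    exact mul_le_mul (le_add_of_nonneg_right (rpow_nonneg (hg₂0 y) _))
      (le_add_of_nonneg_right (hQ₂0 y hy.1)) (hQ₁0 y hy.1) (hfpos _ (hΦmem y).1).le
  have hsup₂ : ∀ r, 0 ≤ r →
      a₂ + ∫ y in (0:ℝ)..r, radialIntegrand κ₂ B₂m B₂p (fun t => f₂ (Φ t) (Φ t)) y ≤ Φ r := by
    intro r hr
    rw [(hΦ r hr).2]
    refine add_le_add (by linarith) (intervalIntegral.integral_mono_on hr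
      (hK₂.intervalIntegrable hg₂m hg₂0 hr) (hΦint r hr) fun y hy => ?_)
    refine (hK₂.integrand_le hg₂m hg₂0 hy.1 le_rfl).trans ?_
    exact mul_le_mul (le_add_of_nonneg_left (rpow_nonneg (hg₁0 y) _))
      (le_add_of_nonneg_left (hQ₁0 y hy.1)) (hQ₂0 y hy.1) (hfpos _ (hΦmem y).1).le
  obtain ⟨u₁, u₂, hu₁, hu₂, hau₁, hau₂, huΦ₁, huΦ₂, heq₁, heq₂⟩ :=
    exists_radial_solution_of_supersolution hK₁ hK₂ ha₁ ha₂ hf₁0 hf₂0 hf₁mono hf₂mono hΦmono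
      (fun r => by linarith [(hΦmem r).1]) (fun r => by linarith [(hΦmem r).1]) hsup₁ hsup₂
  have hu₁0 : ∀ t, 0 ≤ u₁ t := fun t => ha₁.trans (hau₁ t)
  have hu₂0 : ∀ t, 0 ≤ u₂ t := fun t => ha₂.trans (hau₂ t)
  have hfu₁0 : ∀ t, 0 ≤ f₁ (u₁ t) (u₂ t) := fun t => hf₁0 _ (hu₁0 t) _ (hu₂0 t)
  have hfu₂0 : ∀ t, 0 ≤ f₂ (u₁ t) (u₂ t) := fun t => hf₂0 _ (hu₁0 t) _ (hu₂0 t)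
  have hfu₁ : Monotone fun t => f₁ (u₁ t) (u₂ t) := fun s t h =>
    hf₁mono _ _ _ _ (hu₁0 s) (hu₁ h) (hu₂0 s) (hu₂ h)
  have hfu₂ : Monotone fun t => f₂ (u₁ t) (u₂ t) := fun s t h =>
    hf₂mono _ _ _ _ (hu₁0 s) (hu₁ h) (hu₂0 s) (hu₂ h)
  have hΦinv : ∀ r, 0 ≤ r → Φ r = Finv (P₁ r + P₂ r) := fun r hr => by
    rw [← hPadd r hr, ← (hΦ r hr).1, ← hF, hFinv _ (hΦmem r).1]
  refine ⟨u₁, u₂, ⟨?_, ?_, heq₁, heq₂⟩, ⟨M, ?_⟩, ⟨M, ?_⟩, fun r hr => ⟨?_, ?_, ?_, ?_⟩⟩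
  · exact (continuousOn_const.add (hK₁.continuousOn_integral hfu₁ hfu₁0)).congr heq₁
  · exact (continuousOn_const.add (hK₂.continuousOn_integral hfu₂ hfu₂0)).congr heq₂
  · rintro _ ⟨r, -, rfl⟩
    exact (huΦ₁ r).trans (hΦmem r).2
  · rintro _ ⟨r, -, rfl⟩
    exact (huΦ₂ r).trans (hΦmem r).2
  · rw [heq₁ r hr, hP₁]
    exact add_le_add_right (hK₁.le_integral hfu₁ (hf₁0 _ ha₁ _ ha₂)
      (fun t => hf₁mono _ _ _ _ ha₁ (hau₁ t) ha₂ (hau₂ t)) hr) a₁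
  · exact (huΦ₁ r).trans_eq (hΦinv r hr)
  · rw [heq₂ r hr, hP₂]
    exact add_le_add_right (hK₂.le_integral hfu₂ (hf₂0 _ ha₁ _ ha₂)
      (fun t => hf₂mono _ _ _ _ ha₁ (hau₁ t) ha₂ (hau₂ t)) hr) a₂
  · exact (huΦ₂ r).trans_eq (hΦinv r hr)
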